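/- arXiv:2503.21604 — 2 statements merged into one kernel-verified Lean document; each statement's English description precedes it below -/
import Mathlib

section
/- Let N ≥ 2, γ > 0, r* > 0, and let q⁰ = (q₁⁰, …, q_N⁰) ∈ (ℝ²)^N have pairwise distinct components. Then there exists a unique C¹ map q : [0, ∞) → (ℝ²)^N with q(0) = q⁰, with q_i(t) ≠ q_j(t) for all i ≠ j and all t ≥ 0, satisfying for each i and all t ≥ 0 the ODE dq_i/dt = (γ/(2π))·Σ_{j≠i} (q_i − q_j)^⊥/|q_i − q_j|² − (γ/(4π(r*)²))·q_{i,r}·e_z. In other words, the limiting leapfrogging point system has a unique global-in-time solution. -/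
open Finset

/-- Counterclockwise rotation by `π/2`: for `a = (a_z, a_r)`, `a^⊥ = (−a_r, a_z)`.
Points of `ℝ²` are written with coordinate `0` the `z`-coordinate and
coordinate `1` the `r`-coordinate. -/
noncomputable def perp (a : EuclideanSpace ℝ (Fin 2)) : EuclideanSpace ℝ (Fin 2) :=
  (WithLp.equiv 2 (Fin 2 → ℝ)).symm ![-(a 1), a 0]

/-- The unit vector `e_z = (1, 0)`. -/
noncomputable def ez : EuclideanSpace ℝ (Fin 2) :=
  (WithLp.equiv 2 (Fin 2 → ℝ)).symm ![1, 0]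

/-- The right-hand side of the limiting leapfrogging point system. -/
noncomputable def lfRHS (N : ℕ) (γ rstar : ℝ)
    (q : Fin N → EuclideanSpace ℝ (Fin 2)) (i : Fin N) : EuclideanSpace ℝ (Fin 2) :=
  (γ/(2*Real.pi)) • (∑ j ∈ univ.erase i, (‖q i - q j‖^2)⁻¹ • perp (q i - q j))
    - (γ/(4*Real.pi*rstar^2) * q i 1) • ez

/-- `q` is a global-in-time collisionless solution of the limiting leapfrogging point
system with initial datum `q0`. -/
def IsGlobalLFSol (N : ℕ) (γ rstar : ℝ)
    (q0 : Fin N → EuclideanSpace ℝ (Fin 2))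
    (q : ℝ → Fin N → EuclideanSpace ℝ (Fin 2)) : Prop :=
  q 0 = q0 ∧
  (∀ t ∈ Set.Ici (0:ℝ), ∀ i j, i ≠ j → q t i ≠ q t j) ∧
  (∀ i, ∀ t ∈ Set.Ici (0:ℝ),
    HasDerivWithinAt (fun s => q s i) (lfRHS N γ rstar (q t) i) (Set.Ici 0) t)

/-- The plane `ℝ²` with coordinates `(z, r)`. -/
abbrev Plane := EuclideanSpace ℝ (Fin 2)

@[simp] lemma perp_apply_zero (a : Plane) : perp a 0 = -a 1 := by simp [perp]

@[simp] lemma perp_apply_one (a : Plane) : perp a 1 = a 0 := by simp [perp]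

@[simp] lemma ez_apply_zero : ez 0 = 1 := by simp [ez]

@[simp] lemma ez_apply_one : ez 1 = 0 := by simp [ez]

lemma norm_ez : ‖ez‖ = 1 := by
  simp [EuclideanSpace.norm_eq, Fin.sum_univ_two]

/-- `perp` as a linear map. -/
noncomputable def perpLin : Plane →ₗ[ℝ] Plane where
  toFun := perp
  map_add' x y := by ext i; fin_cases i <;> (simp; try ring)
  map_smul' c x := by ext i; fin_cases i <;> simp

lemma perp_sub (x y : Plane) : perp (x - y) = perp x - perp y := perpLin.map_sub x y

lemma perp_smul (c : ℝ) (x : Plane) : perp (c • x) = c • perp x := perpLin.map_smul c x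

lemma perp_sum {ι : Type*} (s : Finset ι) (f : ι → Plane) :
    perp (∑ i ∈ s, f i) = ∑ i ∈ s, perp (f i) := map_sum perpLin f s

lemma norm_perp (x : Plane) : ‖perp x‖ = ‖x‖ := by
  simp [EuclideanSpace.norm_eq, Fin.sum_univ_two, add_comm]

lemma inner_perp_self (x : Plane) : inner ℝ x (perp x) = 0 := by
  simp [PiLp.inner_apply, Fin.sum_univ_two]; ring

lemma inner_ez (x : Plane) : inner ℝ x ez = x 0 := by
  simp [PiLp.inner_apply, Fin.sum_univ_two]

lemma abs_coord_le_norm (x : Plane) (k : Fin 2) : |x k| ≤ ‖x‖ := by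
  simpa using PiLp.norm_apply_le x k

/-- The vector field `x / |x|²`, made globally Lipschitz by a cutoff inside the disc of
radius `δ`. -/
noncomputable def cutoffKernel (δ : ℝ) (x : Plane) : Plane := ((max ‖x‖ δ) ^ 2)⁻¹ • x

lemma cutoffKernel_neg (δ : ℝ) (x : Plane) : cutoffKernel δ (-x) = -cutoffKernel δ x := by
  simp [cutoffKernel]

lemma norm_cutoffKernel_le {δ : ℝ} (hδ : 0 < δ) (x : Plane) : ‖cutoffKernel δ x‖ ≤ δ⁻¹ := by
  have h2 : δ ≤ max ‖x‖ δ := le_max_right _ _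
  have hp : 0 < max ‖x‖ δ := hδ.trans_le h2
  rw [cutoffKernel, norm_smul, Real.norm_of_nonneg (by positivity)]
  calc ((max ‖x‖ δ) ^ 2)⁻¹ * ‖x‖ ≤ ((max ‖x‖ δ) ^ 2)⁻¹ * max ‖x‖ δ := by
        gcongr; exact le_max_left _ _
    _ = (max ‖x‖ δ)⁻¹ := by field_simp
    _ ≤ δ⁻¹ := by gcongr

lemma norm_cutoffKernel_sub_le {δ : ℝ} (hδ : 0 < δ) (x y : Plane) :
    ‖cutoffKernel δ x - cutoffKernel δ y‖ ≤ 3 / δ ^ 2 * ‖x - y‖ := by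
  set p := max ‖x‖ δ with hp_def
  set s := max ‖y‖ δ with hs_def
  have hp : δ ≤ p := le_max_right _ _
  have hs : δ ≤ s := le_max_right _ _
  have hp0 : 0 < p := hδ.trans_le hp
  have hs0 : 0 < s := hδ.trans_le hs
  have hys : ‖y‖ ≤ s := le_max_left _ _
  have hsp : |s - p| ≤ ‖x - y‖ := by
    have h1 : |s - p| ≤ |‖y‖ - ‖x‖| := abs_max_sub_max_le_abs _ _ _
    have h2 := abs_norm_sub_norm_le y x
    rw [norm_sub_rev] at h2
    exact h1.trans h2
  have hsplit : cutoffKernel δ x - cutoffKernel δ y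
      = (p ^ 2)⁻¹ • (x - y) + ((s - p) * ((s + p) / (p ^ 2 * s ^ 2))) • y := by
    have hc : (s - p) * ((s + p) / (p ^ 2 * s ^ 2)) = (p ^ 2)⁻¹ - (s ^ 2)⁻¹ := by
      field_simp; ring
    rw [hc, cutoffKernel, cutoffKernel, ← hp_def, ← hs_def]
    module
  have hfrac : (s + p) / (p ^ 2 * s ^ 2) * ‖y‖ ≤ 2 / δ ^ 2 := by
    calc (s + p) / (p ^ 2 * s ^ 2) * ‖y‖ ≤ (s + p) / (p ^ 2 * s ^ 2) * s := by gcongr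
      _ = 1 / (p * p) + 1 / (p * s) := by field_simp
      _ ≤ 1 / (δ * δ) + 1 / (δ * δ) := by gcongr
      _ = 2 / δ ^ 2 := by field_simp; ring
  calc ‖cutoffKernel δ x - cutoffKernel δ y‖
      ≤ (p ^ 2)⁻¹ * ‖x - y‖ + |s - p| * ((s + p) / (p ^ 2 * s ^ 2) * ‖y‖) := by
        rw [hsplit]
        refine (norm_add_le _ _).trans (le_of_eq ?_)
        rw [norm_smul, norm_smul, Real.norm_of_nonneg (by positivity), norm_mul,
          Real.norm_eq_abs, Real.norm_of_nonneg (by positivity : 0 ≤ (s + p) / (p ^ 2 * s ^ 2)),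
          mul_assoc]
    _ ≤ (δ ^ 2)⁻¹ * ‖x - y‖ + ‖x - y‖ * (2 / δ ^ 2) := by gcongr
    _ = 3 / δ ^ 2 * ‖x - y‖ := by ring

/-- The truncation of a real number to `[-R, R]`. -/
noncomputable def clamp (R x : ℝ) : ℝ := max (min x R) (-R)

lemma abs_clamp_sub_le (R x y : ℝ) : |clamp R x - clamp R y| ≤ |x - y| :=
  (abs_max_sub_max_le_abs _ _ _).trans (abs_inf_sub_inf_le_abs _ _ _)

lemma clamp_of_abs_le {R x : ℝ} (h : |x| ≤ R) : clamp R x = x := by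
  rw [abs_le] at h
  rw [clamp, min_eq_left h.2, max_eq_left h.1]

lemma abs_clamp_le_abs {R : ℝ} (hR : 0 ≤ R) (x : ℝ) : |clamp R x| ≤ |x| := by
  have h := abs_clamp_sub_le R x 0
  rwa [clamp_of_abs_le (x := 0) (by simpa using hR), sub_zero, sub_zero] at h

lemma abs_clamp_le {R : ℝ} (hR : 0 ≤ R) (x : ℝ) : |clamp R x| ≤ R :=
  abs_le.2 ⟨le_max_right _ _, max_le (min_le_right _ _) (by linarith)⟩

/-- The sum of the cut-off kernels acting on the `i`-th point. -/
noncomputable def cutoffForce {N : ℕ} (δ : ℝ) (q : Fin N → Plane) (i : Fin N) : Plane :=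
  ∑ j, cutoffKernel δ (q i - q j)

/-- The leapfrogging vector field with the interaction cut off below distance `δ` and the
radial coordinate truncated at height `R`. -/
noncomputable def cutoffField {N : ℕ} (a b δ R : ℝ) (q : Fin N → Plane) : Fin N → Plane :=
  fun i => a • perp (cutoffForce δ q i) - (b * clamp R (q i 1)) • ez

lemma norm_cutoffField_le {N : ℕ} {a b δ R : ℝ} (hδ : 0 < δ) (hR : 0 ≤ R)
    (q : Fin N → Plane) : ‖cutoffField a b δ R q‖ ≤ |a| * (N * δ⁻¹) + |b| * R := by
  refine (pi_norm_le_iff_of_nonneg (by positivity)).2 fun i => ?_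
  refine (norm_sub_le _ _).trans ?_
  rw [norm_smul, norm_smul, norm_ez, norm_perp, mul_one, norm_mul]
  simp only [Real.norm_eq_abs]
  gcongr
  · refine (norm_sum_le_of_le _ fun j _ => norm_cutoffKernel_le hδ _).trans (le_of_eq ?_)
    simp
  · exact abs_clamp_le hR _

lemma lipschitzWith_cutoffField {N : ℕ} {a b δ R : ℝ} (hδ : 0 < δ) :
    LipschitzWith (|a| * (N * (3 / δ ^ 2 * 2)) + |b|).toNNReal
      (cutoffField (N := N) a b δ R) := by
  refine LipschitzWith.of_dist_le_mul fun q p => ?_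
  rw [Real.coe_toNNReal _ (by positivity), dist_eq_norm, dist_eq_norm]
  refine (pi_norm_le_iff_of_nonneg (by positivity)).2 fun i => ?_
  have hi : ∀ j, ‖q j - p j‖ ≤ ‖q - p‖ := fun j => norm_le_pi_norm (q - p) j
  have hforce : ‖cutoffForce δ q i - cutoffForce δ p i‖ ≤ N * (3 / δ ^ 2 * 2) * ‖q - p‖ := by
    rw [cutoffForce, cutoffForce, ← Finset.sum_sub_distrib]
    have hterm : ∀ j ∈ (univ : Finset (Fin N)),
        ‖cutoffKernel δ (q i - q j) - cutoffKernel δ (p i - p j)‖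
          ≤ 3 / δ ^ 2 * (2 * ‖q - p‖) := by
      intro j _
      refine (norm_cutoffKernel_sub_le hδ _ _).trans ?_
      gcongr
      rw [sub_sub_sub_comm]
      linarith [norm_sub_le (q i - p i) (q j - p j), hi i, hi j]
    refine (norm_sum_le_of_le _ hterm).trans (le_of_eq ?_)
    simp only [sum_const, card_univ, Fintype.card_fin, nsmul_eq_mul]
    ring
  have hsplit : (cutoffField a b δ R q - cutoffField a b δ R p) i
      = a • perp (cutoffForce δ q i - cutoffForce δ p i)
        - (b * (clamp R (q i 1) - clamp R (p i 1))) • ez := by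
    simp only [Pi.sub_apply, cutoffField, perp_sub]
    module
  rw [hsplit]
  refine (norm_sub_le _ _).trans ?_
  rw [norm_smul, norm_smul, norm_ez, norm_perp, mul_one, norm_mul]
  simp only [Real.norm_eq_abs]
  have hclamp : |clamp R (q i 1) - clamp R (p i 1)| ≤ ‖q - p‖ :=
    (abs_clamp_sub_le _ _ _).trans ((abs_coord_le_norm (q i - p i) 1).trans (hi i))
  calc _ ≤ |a| * (N * (3 / δ ^ 2 * 2) * ‖q - p‖) + |b| * ‖q - p‖ := by gcongr
    _ = _ := by ring

lemma lfRHS_eq_cutoffField {N : ℕ} {γ rstar δ R : ℝ} {q : Fin N → Plane}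
    (hd : ∀ i j, i ≠ j → δ ≤ ‖q i - q j‖) (hR : ∀ i, |q i 1| ≤ R) (i : Fin N) :
    lfRHS N γ rstar q i
      = cutoffField (γ / (2 * Real.pi)) (γ / (4 * Real.pi * rstar ^ 2)) δ R q i := by
  rw [lfRHS, cutoffField, clamp_of_abs_le (hR i), cutoffForce, perp_sum,
    ← Finset.add_sum_erase _ _ (mem_univ i)]
  have h0 : perp (cutoffKernel δ (q i - q i)) = 0 := by
    simpa [cutoffKernel] using perp_smul 0 0
  rw [h0, zero_add]
  congr 2
  refine sum_congr rfl fun j hj => ?_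
  rw [cutoffKernel, perp_smul, max_eq_left (hd i j (Finset.ne_of_mem_erase hj).symm)]

/-- A bounded Lipschitz vector field has integral curves on every interval `[0, T]`. -/
lemma exists_solution_of_lipschitz_of_bounded {E : Type*} [NormedAddCommGroup E]
    [NormedSpace ℝ E] [CompleteSpace E] {V : E → E} {K : NNReal} (hV : LipschitzWith K V)
    {L : ℝ} (hL : ∀ x, ‖V x‖ ≤ L) {T : ℝ} (hT : 0 ≤ T) (x₀ : E) :
    ∃ α : ℝ → E, α 0 = x₀ ∧
      ∀ t ∈ Set.Icc 0 T, HasDerivWithinAt α (V (α t)) (Set.Icc 0 T) t := by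
  have hL0 : 0 ≤ L := (norm_nonneg _).trans (hL x₀)
  have hPL : IsPicardLindelof (fun _ => V) (⟨0, le_refl 0, hT⟩ : Set.Icc 0 T) x₀
      (L.toNNReal * T.toNNReal) 0 L.toNNReal K := by
    refine IsPicardLindelof.of_time_independent (fun x _ => ?_) (hV.lipschitzOnWith) ?_
    · rw [Real.coe_toNNReal _ hL0]; exact hL x
    · simp [hL0, hT]
  exact hPL.exists_eq_forall_mem_Icc_hasDerivWithinAt₀

lemma sum_sum_eq_zero_of_antisymm {ι : Type*} [Fintype ι] {f : ι → ι → ℝ}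
    (h : ∀ i j, f i j = -f j i) : ∑ i, ∑ j, f i j = 0 := by
  have h1 : ∑ i, ∑ j, f i j = -∑ i, ∑ j, f i j := by
    conv_rhs => rw [Finset.sum_comm]
    simp only [← Finset.sum_neg_distrib]
    exact sum_congr rfl fun i _ => sum_congr rfl fun j _ => h i j
  linarith

lemma sum_inner_perp_cutoffForce {N : ℕ} (δ : ℝ) (q : Fin N → Plane) :
    ∑ i, inner ℝ (q i) (perp (cutoffForce δ q i)) = 0 := by
  simp only [cutoffForce, perp_sum, inner_sum]
  refine sum_sum_eq_zero_of_antisymm fun i j => ?_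
  have h := inner_perp_self (q i - q j)
  rw [← neg_sub (q i) (q j), cutoffKernel_neg]
  have hneg : perp (-cutoffKernel δ (q i - q j)) = -perp (cutoffKernel δ (q i - q j)) :=
    perpLin.map_neg _
  rw [hneg, inner_neg_right, neg_neg, ← sub_eq_zero, ← inner_sub_left, cutoffKernel, perp_smul,
    real_inner_smul_right, h, mul_zero]

lemma sum_sum_inner_cutoffKernel {N : ℕ} (δ : ℝ) (q v : Fin N → Plane) :
    ∑ i, ∑ j, inner ℝ (cutoffKernel δ (q i - q j)) (v i - v j)
      = 2 * ∑ i, inner ℝ (cutoffForce δ q i) (v i) := by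
  have h1 : ∑ i, ∑ j, inner ℝ (cutoffKernel δ (q i - q j)) (v i)
      = ∑ i, inner ℝ (cutoffForce δ q i) (v i) := by
    simp only [cutoffForce, sum_inner]
  have h2 : ∑ i, ∑ j, inner ℝ (cutoffKernel δ (q i - q j)) (v j)
      = -∑ i, inner ℝ (cutoffForce δ q i) (v i) := by
    rw [← h1, Finset.sum_comm]
    simp only [← Finset.sum_neg_distrib]
    refine sum_congr rfl fun i _ => sum_congr rfl fun j _ => ?_
    rw [← neg_sub (q i) (q j), cutoffKernel_neg, inner_neg_left]
  simp only [inner_sub_right, Finset.sum_sub_distrib, h1, h2]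
  ring

/-- The primitive of `s ↦ 1 / max s ε` that agrees with `log` on `[ε, ∞)`. -/
noncomputable def cutoffLog (ε s : ℝ) : ℝ := (∫ u in ε..s, (max u ε)⁻¹) + Real.log ε

lemma hasDerivAt_cutoffLog {ε : ℝ} (hε : 0 < ε) (s : ℝ) :
    HasDerivAt (cutoffLog ε) (max s ε)⁻¹ s := by
  have hc : Continuous fun u : ℝ => (max u ε)⁻¹ :=
    (continuous_id.max continuous_const).inv₀ fun u => (hε.trans_le (le_max_right _ _)).ne'
  exact (intervalIntegral.integral_hasDerivAt_right (hc.intervalIntegrable _ _)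
    (hc.stronglyMeasurableAtFilter _ _) hc.continuousAt).add_const _

lemma cutoffLog_eq_log {ε s : ℝ} (hε : 0 < ε) (hs : ε ≤ s) : cutoffLog ε s = Real.log s := by
  have h : ∫ u in ε..s, (max u ε)⁻¹ = ∫ u in ε..s, u⁻¹ := by
    refine intervalIntegral.integral_congr fun u hu => ?_
    rw [Set.uIcc_of_le hs] at hu
    simp only [max_eq_left hu.1]
  rw [cutoffLog, h, integral_inv_of_pos hε (hε.trans_le hs),
    Real.log_div (hε.trans_le hs).ne' hε.ne', sub_add_cancel]

lemma monotone_cutoffLog {ε : ℝ} (hε : 0 < ε) : Monotone (cutoffLog ε) :=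
  monotone_of_deriv_nonneg (fun s => (hasDerivAt_cutoffLog hε s).differentiableAt) fun s => by
    rw [(hasDerivAt_cutoffLog hε s).deriv]
    exact inv_nonneg.2 (hε.le.trans (le_max_right _ _))

lemma max_sq_sq {x δ : ℝ} (hx : 0 ≤ x) (hδ : 0 ≤ δ) : max (x ^ 2) (δ ^ 2) = (max x δ) ^ 2 := by
  rcases le_total x δ with h | h
  · rw [max_eq_right h, max_eq_right (by gcongr)]
  · rw [max_eq_left h, max_eq_left (by gcongr)]

lemma hasDerivWithinAt_cutoffLog_norm_sq {δ : ℝ} (hδ : 0 < δ) {f : ℝ → Plane} {f' : Plane}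
    {s : Set ℝ} {t : ℝ} (hf : HasDerivWithinAt f f' s t) :
    HasDerivWithinAt (fun t => cutoffLog (δ ^ 2) (‖f t‖ ^ 2))
      (2 * inner ℝ (cutoffKernel δ (f t)) f') s t := by
  have h := (hasDerivAt_cutoffLog (pow_pos hδ 2) (‖f t‖ ^ 2)).comp_hasDerivWithinAt t hf.norm_sq
  refine h.congr_deriv ?_
  rw [max_sq_sq (norm_nonneg _) hδ.le, cutoffKernel, real_inner_smul_left]
  ring

lemma hasDerivWithinAt_Ici_of_Icc {E : Type*} [NormedAddCommGroup E] [NormedSpace ℝ E]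
    {f : ℝ → E} {f' : E} {T t : ℝ} (ht : t ∈ Set.Ico 0 T)
    (hf : HasDerivWithinAt f f' (Set.Icc 0 T) t) : HasDerivWithinAt f f' (Set.Ici t) t :=
  hf.mono_of_mem_nhdsWithin (Icc_mem_nhdsGE_of_mem ht)

section Trajectory

variable {N : ℕ} {a b δ R T : ℝ} {α : ℝ → Fin N → Plane}

/-- The moment of inertia grows at most exponentially along the cut-off flow. -/
lemma sum_norm_sq_le_of_cutoffField (hR : 0 ≤ R)
    (hα : ∀ t ∈ Set.Icc 0 T,
      HasDerivWithinAt α (cutoffField a b δ R (α t)) (Set.Icc 0 T) t) :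
    ∀ t ∈ Set.Icc 0 T, ∑ i, ‖α t i‖ ^ 2 ≤ (∑ i, ‖α 0 i‖ ^ 2) * Real.exp (2 * |b| * T) := by
  have hder : ∀ t ∈ Set.Icc 0 T, HasDerivWithinAt (fun t => ∑ i, ‖α t i‖ ^ 2)
      (∑ i, 2 * inner ℝ (α t i) (cutoffField a b δ R (α t) i)) (Set.Icc 0 T) t := fun t ht =>
    HasDerivWithinAt.fun_sum fun i _ => (hasDerivWithinAt_pi.1 (hα t ht) i).norm_sq
  have hbound : ∀ t ∈ Set.Ico 0 T,
      ‖∑ i, 2 * inner ℝ (α t i) (cutoffField a b δ R (α t) i)‖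
        ≤ 2 * |b| * ‖∑ i, ‖α t i‖ ^ 2‖ + 0 := by
    intro t _
    have heq : ∑ i, 2 * inner ℝ (α t i) (cutoffField a b δ R (α t) i)
        = ∑ i, -(2 * (b * clamp R (α t i 1)) * α t i 0) := by
      have h0 := sum_inner_perp_cutoffForce δ (α t)
      calc _ = 2 * a * ∑ i, inner ℝ (α t i) (perp (cutoffForce δ (α t) i))
            + ∑ i, -(2 * (b * clamp R (α t i 1)) * α t i 0) := by
            rw [Finset.mul_sum, ← Finset.sum_add_distrib]
            refine sum_congr rfl fun i _ => ?_
            rw [cutoffField, inner_sub_right, real_inner_smul_right, real_inner_smul_right,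
              inner_ez]
            ring
        _ = _ := by rw [h0, mul_zero, zero_add]
    rw [heq, add_zero, Real.norm_of_nonneg (by positivity : 0 ≤ ∑ i, ‖α t i‖ ^ 2),
      Finset.mul_sum]
    refine norm_sum_le_of_le _ fun i _ => ?_
    rw [norm_neg, norm_mul, norm_mul, norm_mul, Real.norm_ofNat]
    simp only [Real.norm_eq_abs]
    have h1 := (abs_clamp_le_abs hR (α t i 1)).trans (abs_coord_le_norm (α t i) 1)
    have h2 := abs_coord_le_norm (α t i) 0
    calc 2 * (|b| * |clamp R (α t i 1)|) * |α t i 0| ≤ 2 * (|b| * ‖α t i‖) * ‖α t i‖ := by gcongr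
      _ = 2 * |b| * ‖α t i‖ ^ 2 := by ring
  intro t ht
  have h := norm_le_gronwallBound_of_norm_deriv_right_le
    (fun t ht => (hder t ht).continuousWithinAt)
    (fun t ht => hasDerivWithinAt_Ici_of_Icc ht (hder t (Set.Ico_subset_Icc_self ht)))
    le_rfl hbound t ht
  have hn : ∀ t, ‖∑ i, ‖α t i‖ ^ 2‖ = ∑ i, ‖α t i‖ ^ 2 := fun t =>
    Real.norm_of_nonneg (by positivity)
  rw [hn, hn, gronwallBound_ε0] at h
  refine h.trans ?_
  gcongr
  linarith [ht.2]

/-- The cut-off Hamiltonian is conserved as long as the truncation is inactive. -/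
lemma energy_eq_of_cutoffField (hδ : 0 < δ)
    (hα : ∀ t ∈ Set.Icc 0 T,
      HasDerivWithinAt α (cutoffField a b δ R (α t)) (Set.Icc 0 T) t)
    (hαR : ∀ t ∈ Set.Icc 0 T, ∀ i, |α t i 1| ≤ R) :
    ∀ t ∈ Set.Icc 0 T,
      a * (∑ i, ∑ j, cutoffLog (δ ^ 2) (‖α t i - α t j‖ ^ 2)) + 2 * b * ∑ i, α t i 1 ^ 2
        = a * (∑ i, ∑ j, cutoffLog (δ ^ 2) (‖α 0 i - α 0 j‖ ^ 2)) + 2 * b * ∑ i, α 0 i 1 ^ 2 := by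
  have hder : ∀ t ∈ Set.Icc 0 T, HasDerivWithinAt (fun t =>
      a * (∑ i, ∑ j, cutoffLog (δ ^ 2) (‖α t i - α t j‖ ^ 2)) + 2 * b * ∑ i, α t i 1 ^ 2)
      0 (Set.Icc 0 T) t := by
    intro t ht
    have hpt := hasDerivWithinAt_pi.1 (hα t ht)
    have hcoord : ∀ i, HasDerivWithinAt (fun t => α t i 1) (a * cutoffForce δ (α t) i 0)
        (Set.Icc 0 T) t := fun i => by
      have h := (EuclideanSpace.proj (𝕜 := ℝ) (1 : Fin 2)).hasFDerivAt.comp_hasDerivWithinAt t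
        (hpt i)
      exact h.congr_deriv (by simp [cutoffField])
    have hlog := HasDerivWithinAt.fun_sum fun i (_ : i ∈ univ) =>
      HasDerivWithinAt.fun_sum fun j (_ : j ∈ univ) =>
        hasDerivWithinAt_cutoffLog_norm_sq hδ ((hpt i).sub (hpt j))
    have hsq := HasDerivWithinAt.fun_sum fun i (_ : i ∈ univ) => (hcoord i).pow 2
    refine ((hlog.const_mul a).add (hsq.const_mul (2 * b))).congr_deriv ?_
    simp only [← Finset.mul_sum]
    have hs := sum_sum_inner_cutoffKernel δ (α t) (cutoffField a b δ R (α t))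
    simp only [Pi.sub_apply] at hs ⊢
    rw [hs]
    simp only [Finset.mul_sum, ← Finset.sum_add_distrib]
    refine sum_eq_zero fun i _ => ?_
    rw [cutoffField, inner_sub_right, real_inner_smul_right, real_inner_smul_right, inner_ez,
      inner_perp_self, clamp_of_abs_le (hαR t ht i)]
    simp only [Nat.cast_ofNat, Nat.add_one_sub_one, pow_one]
    ring
  exact constant_of_has_deriv_right_zero (fun t ht => (hder t ht).continuousWithinAt)
    fun t ht => hasDerivWithinAt_Ici_of_Icc ht (hder t (Set.Ico_subset_Icc_self ht))

end Trajectory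

/-- A collisionless solution of the limiting leapfrogging point system on `[0, T]`. -/
def IsLFSolOn (N : ℕ) (γ rstar : ℝ) (q0 : Fin N → Plane) (T : ℝ) (q : ℝ → Fin N → Plane) :
    Prop :=
  q 0 = q0 ∧
  (∀ t ∈ Set.Icc 0 T, ∀ i j, i ≠ j → q t i ≠ q t j) ∧
  (∀ i, ∀ t ∈ Set.Icc 0 T,
    HasDerivWithinAt (fun s => q s i) (lfRHS N γ rstar (q t) i) (Set.Icc 0 T) t)

lemma IsLFSolOn.mono {N : ℕ} {γ rstar : ℝ} {q0 : Fin N → Plane} {T T' : ℝ}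
    {q : ℝ → Fin N → Plane} (h : IsLFSolOn N γ rstar q0 T q) (hT : T' ≤ T) :
    IsLFSolOn N γ rstar q0 T' q :=
  have hsub : Set.Icc 0 T' ⊆ Set.Icc 0 T := Set.Icc_subset_Icc_right hT
  ⟨h.1, fun t ht => h.2.1 t (hsub ht), fun i t ht => (h.2.2 i t (hsub ht)).mono hsub⟩

lemma IsGlobalLFSol.isLFSolOn {N : ℕ} {γ rstar : ℝ} {q0 : Fin N → Plane}
    {q : ℝ → Fin N → Plane} (h : IsGlobalLFSol N γ rstar q0 q) (T : ℝ) :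
    IsLFSolOn N γ rstar q0 T q :=
  have hsub : Set.Icc 0 T ⊆ Set.Ici 0 := Set.Icc_subset_Ici_self
  ⟨h.1, fun t ht => h.2.1 t (hsub ht), fun i t ht => (h.2.2 i t (hsub ht)).mono hsub⟩

lemma exists_pos_forall_le {ι : Type*} [Finite ι] {c : ι → ℝ} (hc : ∀ i, 0 < c i) :
    ∃ δ > 0, ∀ i, δ ≤ c i := by
  have h : ∀ᶠ δ in nhdsWithin (0 : ℝ) (Set.Ioi 0), ∀ i, δ ≤ c i :=
    Filter.eventually_all.2 fun i =>
      ((eventually_lt_nhds (hc i)).filter_mono nhdsWithin_le_nhds).mono fun _ h => h.le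
  obtain ⟨δ, h1, h2⟩ := (h.and self_mem_nhdsWithin).exists
  exact ⟨δ, h2, h1⟩

lemma IsLFSolOn.continuousOn {N : ℕ} {γ rstar : ℝ} {q0 : Fin N → Plane} {T : ℝ}
    {q : ℝ → Fin N → Plane} (h : IsLFSolOn N γ rstar q0 T q) : ContinuousOn q (Set.Icc 0 T) :=
  continuousOn_pi.2 fun i t ht => (h.2.2 i t ht).continuousWithinAt

lemma IsLFSolOn.exists_bounds {N : ℕ} {γ rstar : ℝ} {q0 : Fin N → Plane} {T : ℝ}
    {q : ℝ → Fin N → Plane} (h : IsLFSolOn N γ rstar q0 T q) :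
    ∃ δ > 0, ∃ R, ∀ t ∈ Set.Icc 0 T,
      (∀ i j, i ≠ j → δ ≤ ‖q t i - q t j‖) ∧ ∀ i, |q t i 1| ≤ R := by
  obtain ⟨R, hR⟩ := isCompact_Icc.exists_bound_of_continuousOn h.continuousOn
  have hpair : ∀ p : Fin N × Fin N, ∃ c > 0, ∀ t ∈ Set.Icc 0 T,
      p.1 ≠ p.2 → c ≤ ‖q t p.1 - q t p.2‖ := by
    intro p
    by_cases hp : p.1 = p.2
    · exact ⟨1, one_pos, fun _ _ hne => absurd hp hne⟩
    · have hcont := continuousOn_pi.1 h.continuousOn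
      obtain ⟨c, hc, hle⟩ := isCompact_Icc.exists_forall_le'
        ((hcont p.1).sub (hcont p.2)).norm
        (fun t ht => norm_pos_iff.2 (sub_ne_zero.2 (h.2.1 t ht _ _ hp)))
      exact ⟨c, hc, fun t ht _ => hle t ht⟩
  choose c hc hle using hpair
  obtain ⟨δ, hδ, hδc⟩ := exists_pos_forall_le hc
  exact ⟨δ, hδ, R, fun t ht => ⟨fun i j hij => (hδc (i, j)).trans (hle (i, j) t ht hij),
    fun i => (abs_coord_le_norm _ _).trans ((norm_le_pi_norm _ i).trans (hR t ht))⟩⟩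

lemma IsLFSolOn.hasDerivWithinAt_cutoffField {N : ℕ} {γ rstar : ℝ} {q0 : Fin N → Plane} {T : ℝ}
    {q : ℝ → Fin N → Plane} (h : IsLFSolOn N γ rstar q0 T q) {δ R t : ℝ}
    (ht : t ∈ Set.Icc 0 T) (hd : ∀ i j, i ≠ j → δ ≤ ‖q t i - q t j‖)
    (hR : ∀ i, |q t i 1| ≤ R) :
    HasDerivWithinAt q
      (cutoffField (γ / (2 * Real.pi)) (γ / (4 * Real.pi * rstar ^ 2)) δ R (q t))
      (Set.Icc 0 T) t :=
  hasDerivWithinAt_pi.2 fun i => by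
    rw [← lfRHS_eq_cutoffField hd hR]
    exact h.2.2 i t ht

lemma IsLFSolOn.eqOn {N : ℕ} {γ rstar : ℝ} {q0 : Fin N → Plane} {T : ℝ}
    {q p : ℝ → Fin N → Plane} (hq : IsLFSolOn N γ rstar q0 T q)
    (hp : IsLFSolOn N γ rstar q0 T p) : Set.EqOn q p (Set.Icc 0 T) := by
  obtain ⟨δ₁, hδ₁, R₁, h₁⟩ := hq.exists_bounds
  obtain ⟨δ₂, hδ₂, R₂, h₂⟩ := hp.exists_bounds
  have hmem : ∀ {t : ℝ}, t ∈ Set.Ico 0 T → t ∈ Set.Icc 0 T := fun ht =>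
    Set.Ico_subset_Icc_self ht
  refine ODE_solution_unique_of_mem_Icc_right (s := fun _ => Set.univ)
    (v := fun _ => cutoffField (γ / (2 * Real.pi)) (γ / (4 * Real.pi * rstar ^ 2))
      (min δ₁ δ₂) (max R₁ R₂))
    (fun _ _ => (lipschitzWith_cutoffField (lt_min hδ₁ hδ₂)).lipschitzOnWith)
    hq.continuousOn
    (fun t ht => hasDerivWithinAt_Ici_of_Icc ht (hq.hasDerivWithinAt_cutoffField (hmem ht)
      (fun i j hij => (min_le_left _ _).trans ((h₁ t (hmem ht)).1 i j hij))
      (fun i => ((h₁ t (hmem ht)).2 i).trans (le_max_left _ _))))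
    (fun _ _ => Set.mem_univ _) hp.continuousOn
    (fun t ht => hasDerivWithinAt_Ici_of_Icc ht (hp.hasDerivWithinAt_cutoffField (hmem ht)
      (fun i j hij => (min_le_right _ _).trans ((h₂ t (hmem ht)).1 i j hij))
      (fun i => ((h₂ t (hmem ht)).2 i).trans (le_max_right _ _))))
    (fun _ _ => Set.mem_univ _) (hq.1.trans hp.1.symm)

/-- A lower bound on the cut-off interaction energy prevents close encounters when the cutoff
radius is small enough. -/
lemma le_norm_sub_of_energy {N : ℕ} {δ m S C : ℝ} (hδ : 0 < δ) (hm : 0 < m) (hmS : m ≤ S)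
    (hδm : δ ^ 2 ≤ m)
    (hlog : Real.log (δ ^ 2) < Real.log m - (N * N) * (Real.log S - Real.log m) - C)
    {q p : Fin N → Plane} (hp : ∀ i j, i ≠ j → m ≤ ‖p i - p j‖ ^ 2)
    (hq : ∀ i j, ‖q i - q j‖ ^ 2 ≤ S)
    (hE : ∑ i, ∑ j, cutoffLog (δ ^ 2) (‖p i - p j‖ ^ 2) - C
      ≤ ∑ i, ∑ j, cutoffLog (δ ^ 2) (‖q i - q j‖ ^ 2)) {k l : Fin N} (hkl : k ≠ l) :
    δ ≤ ‖q k - q l‖ := by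
  by_contra! hlt
  have hε : 0 < δ ^ 2 := by positivity
  have hA : 0 ≤ Real.log S - Real.log m := sub_nonneg.2 (Real.log_le_log hm hmS)
  have hp' : ∀ i j, i ≠ j → Real.log m ≤ cutoffLog (δ ^ 2) (‖p i - p j‖ ^ 2) := fun i j hij => by
    rw [← cutoffLog_eq_log hε hδm]
    exact monotone_cutoffLog hε (hp i j hij)
  have hterm : ∀ x : Fin N × Fin N,
      cutoffLog (δ ^ 2) (‖q x.1 - q x.2‖ ^ 2) - cutoffLog (δ ^ 2) (‖p x.1 - p x.2‖ ^ 2)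
        ≤ (Real.log S - Real.log m)
          + if x = (k, l) then Real.log (δ ^ 2) - Real.log m else 0 := by
    intro x
    split_ifs with hx
    · subst hx
      have h1 := monotone_cutoffLog hε (pow_le_pow_left₀ (norm_nonneg _) hlt.le 2)
      rw [cutoffLog_eq_log hε le_rfl] at h1
      linarith [hp' k l hkl]
    · by_cases hij : x.1 = x.2
      · simpa [hij] using hA
      · have h1 := monotone_cutoffLog hε (hq x.1 x.2)
        rw [cutoffLog_eq_log hε (hδm.trans hmS)] at h1
        linarith [hp' x.1 x.2 hij]
  have hsum := Finset.sum_le_sum fun x (_ : x ∈ univ) => hterm x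
  rw [Finset.sum_sub_distrib, Finset.sum_add_distrib, Fintype.sum_prod_type,
    Fintype.sum_prod_type, Finset.sum_ite_eq' univ (k, l)] at hsum
  simp only [sum_const, card_univ, Fintype.card_prod, Fintype.card_fin, nsmul_eq_mul,
    mem_univ, if_true, Nat.cast_mul] at hsum
  linarith

lemma exists_isLFSolOn {N : ℕ} {γ rstar : ℝ} (hγ : 0 < γ) (hr : 0 < rstar)
    {q0 : Fin N → Plane} (hq0 : ∀ i j, i ≠ j → q0 i ≠ q0 j) {T : ℝ} (hT : 0 ≤ T) :
    ∃ q, IsLFSolOn N γ rstar q0 T q := by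
  set a := γ / (2 * Real.pi) with ha_def
  set b := γ / (4 * Real.pi * rstar ^ 2) with hb_def
  have ha : 0 < a := by positivity
  have hb : 0 < b := by positivity
  set B := (∑ i, ‖q0 i‖ ^ 2) * Real.exp (2 * |b| * T) with hB_def
  have hB : 0 ≤ B := by positivity
  obtain ⟨m, hm, hm1, hmq⟩ : ∃ m > 0, m ≤ 1 ∧ ∀ i j, i ≠ j → m ≤ ‖q0 i - q0 j‖ ^ 2 := by
    have hc : ∀ x : Fin N × Fin N, 0 < if x.1 = x.2 then 1 else ‖q0 x.1 - q0 x.2‖ ^ 2 := by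
      intro x
      split_ifs with hx
      · exact one_pos
      · exact pow_pos (norm_pos_iff.2 (sub_ne_zero.2 (hq0 _ _ hx))) 2
    obtain ⟨m, hm, hle⟩ := exists_pos_forall_le hc
    refine ⟨min m 1, lt_min hm one_pos, min_le_right _ _, fun i j hij => ?_⟩
    have h := hle (i, j)
    rw [if_neg hij] at h
    exact (min_le_left _ _).trans h
  set S := 4 * B + 1 with hS_def
  have hmS : m ≤ S := by linarith
  have hA : 0 ≤ Real.log S - Real.log m := sub_nonneg.2 (Real.log_le_log hm hmS)
  set C := 2 * b * B / a with hC_def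
  have hC : 0 ≤ C := by positivity
  set L := Real.log m - (N * N) * (Real.log S - Real.log m) - C - 1 with hL_def
  set δ := Real.exp (L / 2) with hδ_def
  have hδ : 0 < δ := Real.exp_pos _
  have hδ2 : δ ^ 2 = Real.exp L := by
    rw [hδ_def, ← Real.exp_nat_mul]
    congr 1
    push_cast
    ring
  have hδm : δ ^ 2 ≤ m := by
    rw [hδ2, ← Real.le_log_iff_exp_le hm]
    have : 0 ≤ (N * N) * (Real.log S - Real.log m) := by positivity
    linarith
  obtain ⟨α, hα0, hα⟩ := exists_solution_of_lipschitz_of_bounded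
    (lipschitzWith_cutoffField (N := N) (a := a) (b := b) (R := √B) hδ)
    (norm_cutoffField_le hδ (Real.sqrt_nonneg B)) hT q0
  have hmom := sum_norm_sq_le_of_cutoffField (Real.sqrt_nonneg B) hα
  rw [hα0] at hmom
  have hnorm : ∀ t ∈ Set.Icc 0 T, ∀ i, ‖α t i‖ ^ 2 ≤ B := fun t ht i =>
    (Finset.single_le_sum (f := fun i => ‖α t i‖ ^ 2) (fun _ _ => by positivity)
      (mem_univ i)).trans (hmom t ht)
  have hαR : ∀ t ∈ Set.Icc 0 T, ∀ i, |α t i 1| ≤ √B := fun t ht i =>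
    (abs_coord_le_norm _ _).trans (Real.le_sqrt_of_sq_le (hnorm t ht i))
  have hen := energy_eq_of_cutoffField hδ hα hαR
  have hsep : ∀ t ∈ Set.Icc 0 T, ∀ i j, i ≠ j → δ ≤ ‖α t i - α t j‖ := by
    intro t ht i j hij
    refine le_norm_sub_of_energy (C := C) hδ hm hmS hδm ?_ hmq (fun i j => ?_) ?_ hij
    · rw [hδ2, Real.log_exp]
      linarith
    · have h1 := parallelogram_law_with_norm ℝ (α t i) (α t j)
      nlinarith [hnorm t ht i, hnorm t ht j, sq_nonneg ‖α t i + α t j‖]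
    · have h1 := hen t ht
      rw [hα0] at h1
      have h2 : ∑ i, α t i 1 ^ 2 ≤ B := by
        refine (Finset.sum_le_sum fun i _ => ?_).trans (hmom t ht)
        rw [← sq_abs]
        gcongr
        exact abs_coord_le_norm _ _
      have h3 : 0 ≤ ∑ i, q0 i 1 ^ 2 := by positivity
      have h4 : a * C = 2 * b * B := by rw [hC_def]; field_simp
      refine le_of_mul_le_mul_left ?_ ha
      rw [mul_sub, h4]
      nlinarith
  refine ⟨α, hα0, fun t ht i j hij heq => ?_, fun i t ht => ?_⟩
  · have h := hsep t ht i j hij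
    rw [heq, sub_self, norm_zero] at h
    exact hδ.not_ge h
  · rw [lfRHS_eq_cutoffField (hsep t ht) (hαR t ht)]
    exact hasDerivWithinAt_pi.1 (hα t ht) i

/-- Global existence and uniqueness for the limiting leapfrogging point system: for any
initial datum with pairwise distinct components there is exactly one global-in-time
collisionless `C¹` solution on `[0, ∞)`. -/
theorem stmt_14 (N : ℕ) (hN : 2 ≤ N) (γ rstar : ℝ) (hγ : 0 < γ) (hr : 0 < rstar)
    (q0 : Fin N → EuclideanSpace ℝ (Fin 2)) (hq0 : ∀ i j, i ≠ j → q0 i ≠ q0 j) :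
    ∃ q : ℝ → Fin N → EuclideanSpace ℝ (Fin 2),
      IsGlobalLFSol N γ rstar q0 q ∧
      ∀ q' : ℝ → Fin N → EuclideanSpace ℝ (Fin 2),
        IsGlobalLFSol N γ rstar q0 q' → ∀ t ∈ Set.Ici (0:ℝ), q' t = q t := by
  choose Q hQ using fun n : ℕ => exists_isLFSolOn (T := n) hγ hr hq0 n.cast_nonneg
  set q : ℝ → Fin N → Plane := fun t => Q (⌊t⌋₊ + 1) t with hq_def
  have hlt : ∀ t : ℝ, t < (⌊t⌋₊ + 1 : ℕ) := fun t => by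
    push_cast
    exact Nat.lt_floor_add_one t
  have hqQ : ∀ n : ℕ, ∀ t ∈ Set.Icc (0 : ℝ) n, q t = Q n t := fun n t ht =>
    ((hQ _).mono (hlt t).le).eqOn ((hQ n).mono ht.2) ⟨ht.1, le_rfl⟩
  have hq : IsGlobalLFSol N γ rstar q0 q := by
    refine ⟨(hQ _).1, fun t ht => (hQ _).2.1 t ⟨ht, (hlt t).le⟩, fun i t ht => ?_⟩
    set n := ⌊t⌋₊ + 1 with hn
    have hmem : t ∈ Set.Icc (0 : ℝ) n := ⟨ht, (hlt t).le⟩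
    have h := ((hQ n).2.2 i t hmem).congr (fun s hs => congrFun (hqQ n s hs) i)
      (congrFun (hqQ n t hmem) i)
    rw [← hqQ n t hmem] at h
    refine h.mono_of_mem_nhdsWithin ?_
    filter_upwards [self_mem_nhdsWithin, nhdsWithin_le_nhds (Iio_mem_nhds (hlt t))] with s hs hs'
    exact ⟨hs, le_of_lt hs'⟩
  exact ⟨q, hq, fun q' hq' t ht => (hq'.isLFSolOn t).eqOn (hq.isLFSolOn t) ⟨ht, le_rfl⟩⟩
end

section
/- Let γ > 0, r* > 0, L ≥ 1, T > 0, and let (Y₁, Y₂) : [0, T] → (ℝ²)² be C¹ with Y₁(t) ≠ Y₂(t) and 1 + Y_{i,r}(t)/(r*·√L) > 0 for i = 1, 2 and all t ∈ [0, T], satisfying for {i, j} = {1, 2} the system dY_i/dt = (γ/(2π))·(Y_i − Y_j)^⊥/|Y_i − Y_j|² + √L·(γ/(4πr*))·((1 + Y_{i,r}/(r*·√L))^{−1} − 1)·e_z. Then: (i) Y_{1,r}(t) + Y_{2,r}(t) is constant on [0, T]; (ii) for all t, d/dt[(Y_{1,z}(t) + Y_{2,z}(t))/2] = √L·(γ/(8πr*))·((1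 + Y_{1,r}(t)/(r*·√L))^{−1} + (1 + Y_{2,r}(t)/(r*·√L))^{−1} − 2); (iii) if moreover Y_{1,r}(0) + Y_{2,r}(0) = 0, then, writing a(t) = Y_{1,r}(t)/(r*·√L) (so |a(t)| < 1), this derivative equals √L·(γ/(8πr*))·2a(t)²/(1 − a(t)²), and in particular the vertical coordinate of the center of mass (Y_{1,z} + Y_{2,z})/2 is nondecreasing on [0, T]. -/
theorem HasDerivWithinAt.euclidean_apply {ι : Type*} [Fintype ι]
    {f : ℝ → EuclideanSpace ℝ ι} {f' : EuclideanSpace ℝ ι} {s : Set ℝ} {t : ℝ}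
    (h : HasDerivWithinAt f f' s t) (i : ι) :
    HasDerivWithinAt (fun u => f u i) (f' i) s t :=
  (EuclideanSpace.proj (𝕜 := ℝ) i).hasFDerivAt.comp_hasDerivWithinAt t h

theorem inv_one_add_add_inv_one_sub (a : ℝ) (h₁ : 0 < 1 + a) (h₂ : 0 < 1 - a) :
    (1 + a)⁻¹ + (1 - a)⁻¹ - 2 = 2 * a ^ 2 / (1 - a ^ 2) := by
  have h : 1 - a ^ 2 = (1 + a) * (1 - a) := by ring
  rw [h]
  field_simp
  ring

/-- For the two-ring `ε`-dependent leapfrogging system in the vertically moving frame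
rescaled by `√L`: (i) `Y_{1,r} + Y_{2,r}` is conserved; (ii) the vertical velocity of
the center of mass is
`√L·(γ/(8πr*))·((1 + Y_{1,r}/(r*√L))⁻¹ + (1 + Y_{2,r}/(r*√L))⁻¹ − 2)`;
(iii) if `Y_{1,r}(0) + Y_{2,r}(0) = 0` then, with `a(t) = Y_{1,r}(t)/(r*√L)`, one has
`|a(t)| < 1`, the vertical velocity of the center of mass equals
`√L·(γ/(8πr*))·2a(t)²/(1 − a(t)²)`, and the vertical coordinate of the center of mass
is nondecreasing on `[0, T]`. -/
theorem stmt_18 (γ rstar L T : ℝ) (hγ : 0 < γ) (hr : 0 < rstar) (hL : 1 ≤ L)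
    (hT : 0 < T)
    (Y₁ Y₂ : ℝ → EuclideanSpace ℝ (Fin 2))
    (hsep : ∀ t ∈ Set.Icc (0:ℝ) T, Y₁ t ≠ Y₂ t)
    (hpos : ∀ t ∈ Set.Icc (0:ℝ) T,
      0 < 1 + Y₁ t 1 / (rstar * Real.sqrt L) ∧ 0 < 1 + Y₂ t 1 / (rstar * Real.sqrt L))
    (h1 : ∀ t ∈ Set.Icc (0:ℝ) T,
      HasDerivWithinAt Y₁
        ((γ/(2*Real.pi)) • ((‖Y₁ t - Y₂ t‖^2)⁻¹ • perp (Y₁ t - Y₂ t))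
          + (Real.sqrt L * (γ/(4*Real.pi*rstar)) *
              ((1 + Y₁ t 1 / (rstar * Real.sqrt L))⁻¹ - 1)) • ez)
        (Set.Icc 0 T) t)
    (h2 : ∀ t ∈ Set.Icc (0:ℝ) T,
      HasDerivWithinAt Y₂
        ((γ/(2*Real.pi)) • ((‖Y₂ t - Y₁ t‖^2)⁻¹ • perp (Y₂ t - Y₁ t))
          + (Real.sqrt L * (γ/(4*Real.pi*rstar)) *
              ((1 + Y₂ t 1 / (rstar * Real.sqrt L))⁻¹ - 1)) • ez)
        (Set.Icc 0 T) t) :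
    (∀ t ∈ Set.Icc (0:ℝ) T, Y₁ t 1 + Y₂ t 1 = Y₁ 0 1 + Y₂ 0 1) ∧
    (∀ t ∈ Set.Icc (0:ℝ) T,
      HasDerivWithinAt (fun s => (Y₁ s 0 + Y₂ s 0)/2)
        (Real.sqrt L * (γ/(8*Real.pi*rstar)) *
          ((1 + Y₁ t 1 / (rstar * Real.sqrt L))⁻¹
            + (1 + Y₂ t 1 / (rstar * Real.sqrt L))⁻¹ - 2))
        (Set.Icc 0 T) t) ∧
    (Y₁ 0 1 + Y₂ 0 1 = 0 →
      (∀ t ∈ Set.Icc (0:ℝ) T, |Y₁ t 1 / (rstar * Real.sqrt L)| < 1) ∧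
      (∀ t ∈ Set.Icc (0:ℝ) T,
        HasDerivWithinAt (fun s => (Y₁ s 0 + Y₂ s 0)/2)
          (Real.sqrt L * (γ/(8*Real.pi*rstar)) *
            (2 * (Y₁ t 1 / (rstar * Real.sqrt L))^2 /
              (1 - (Y₁ t 1 / (rstar * Real.sqrt L))^2)))
          (Set.Icc 0 T) t) ∧
      MonotoneOn (fun s => (Y₁ s 0 + Y₂ s 0)/2) (Set.Icc 0 T)) := by
  have hsum : ∀ t ∈ Set.Icc (0:ℝ) T, Y₁ t 1 + Y₂ t 1 = Y₁ 0 1 + Y₂ 0 1 := by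
    have hd : ∀ t ∈ Set.Icc (0:ℝ) T,
        HasDerivWithinAt (fun s => Y₁ s 1 + Y₂ s 1) 0 (Set.Icc 0 T) t := by
      intro t ht
      refine (((h1 t ht).euclidean_apply 1).add ((h2 t ht).euclidean_apply 1)).congr_deriv ?_
      rw [norm_sub_rev (Y₂ t) (Y₁ t)]
      simp [perp, ez]
      ring
    exact constant_of_derivWithin_zero (fun t ht => (hd t ht).differentiableWithinAt)
      fun t ht => (hd t (Set.Ico_subset_Icc_self ht)).derivWithin
        (uniqueDiffOn_Icc hT t (Set.Ico_subset_Icc_self ht))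
  have hcenter : ∀ t ∈ Set.Icc (0:ℝ) T,
      HasDerivWithinAt (fun s => (Y₁ s 0 + Y₂ s 0)/2)
        (Real.sqrt L * (γ/(8*Real.pi*rstar)) *
          ((1 + Y₁ t 1 / (rstar * Real.sqrt L))⁻¹
            + (1 + Y₂ t 1 / (rstar * Real.sqrt L))⁻¹ - 2))
        (Set.Icc 0 T) t := by
    intro t ht
    refine ((((h1 t ht).euclidean_apply 0).add
      ((h2 t ht).euclidean_apply 0)).div_const 2).congr_deriv ?_
    rw [norm_sub_rev (Y₂ t) (Y₁ t)]
    simp [perp, ez]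
    ring
  refine ⟨hsum, hcenter, fun h0 => ?_⟩
  have hneg : ∀ t ∈ Set.Icc (0:ℝ) T,
      Y₂ t 1 / (rstar * Real.sqrt L) = -(Y₁ t 1 / (rstar * Real.sqrt L)) := by
    intro t ht
    rw [← neg_div, eq_neg_of_add_eq_zero_right ((hsum t ht).trans h0)]
  have habs : ∀ t ∈ Set.Icc (0:ℝ) T, |Y₁ t 1 / (rstar * Real.sqrt L)| < 1 := by
    intro t ht
    have hp := hpos t ht
    rw [hneg t ht] at hp
    exact abs_lt.2 ⟨by linarith [hp.1], by linarith [hp.2]⟩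
  have hderiv : ∀ t ∈ Set.Icc (0:ℝ) T,
      HasDerivWithinAt (fun s => (Y₁ s 0 + Y₂ s 0)/2)
        (Real.sqrt L * (γ/(8*Real.pi*rstar)) *
          (2 * (Y₁ t 1 / (rstar * Real.sqrt L))^2 /
            (1 - (Y₁ t 1 / (rstar * Real.sqrt L))^2)))
        (Set.Icc 0 T) t := by
    intro t ht
    have ha := abs_lt.1 (habs t ht)
    rw [← inv_one_add_add_inv_one_sub _ (by linarith [ha.1]) (by linarith [ha.2]),
      sub_eq_add_neg (1 : ℝ), ← hneg t ht]
    exact hcenter t ht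
  refine ⟨habs, hderiv, monotoneOn_of_hasDerivWithinAt_nonneg (convex_Icc 0 T)
    (fun t ht => (hderiv t ht).continuousWithinAt)
    (fun t ht => (hderiv t (interior_subset ht)).mono interior_subset) fun t ht => ?_⟩
  have hsq : 0 ≤ 1 - (Y₁ t 1 / (rstar * Real.sqrt L))^2 :=
    sub_nonneg.2 ((sq_lt_one_iff_abs_lt_one _).2 (habs t (interior_subset ht))).le
  positivity
end
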